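/- Let Λ be a finitely aligned k-graph, let 𝓔 ⊆ FE(Λ) be satiated, and let v be a vertex of Λ. Then v∂(Λ;𝓔), the set of 𝓔-compatible boundary paths x with r(x) = v, is nonempty. -/

import Mathlib

open scoped ENNReal

attribute [local instance] Classical.propDecidable

/-- Product of `f` over a set `S`, in some arbitrary order (junk value `1` if `S` is
infinite).  Used for products of commuting projections. -/
noncomputable def listProd {ι A : Type*} [Monoid A] (S : Set ι) (f : ι → A) : A :=
  if h : S.Finite then (h.toFinset.toList.map f).prod else 1

/-- A `k`-graph: a countable category `Λ` (whose morphisms are the terms of `Path`, with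
vertices identified with the morphisms of degree `0`) together with a degree functor
`d : Λ → ℕ^k` satisfying the factorisation property. -/
structure KGraph (k : ℕ) where
  Path : Type
  countable : Countable Path
  d : Path → Fin k → ℕ
  r : Path → Path
  s : Path → Path
  comp : Path → Path → Path
  d_r : ∀ lam, d (r lam) = 0
  d_s : ∀ lam, d (s lam) = 0
  r_r : ∀ lam, r (r lam) = r lam
  s_r : ∀ lam, s (r lam) = r lam
  r_s : ∀ lam, r (s lam) = s lam
  s_s : ∀ lam, s (s lam) = s lam
  comp_source : ∀ lam, comp lam (s lam) = lam
  range_comp : ∀ lam, comp (r lam) lam = lam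
  r_comp : ∀ lam mu, s lam = r mu → r (comp lam mu) = r lam
  s_comp : ∀ lam mu, s lam = r mu → s (comp lam mu) = s mu
  d_comp : ∀ lam mu, s lam = r mu → d (comp lam mu) = d lam + d mu
  comp_assoc : ∀ lam mu nu, s lam = r mu → s mu = r nu →
    comp (comp lam mu) nu = comp lam (comp mu nu)
  factor : ∀ lam m n, d lam = m + n →
    ∃! p : Path × Path, s p.1 = r p.2 ∧ d p.1 = m ∧ d p.2 = n ∧ comp p.1 p.2 = lam

namespace KGraph

variable {k : ℕ} (Λ : KGraph k)

/-- Vertices are identified with the paths of degree `0`. -/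
def IsVertex (v : Λ.Path) : Prop := Λ.d v = 0

/-- The unique factorisation of `lam` as a product of a path of degree `m` and the
remaining tail (junk value if `¬ m ≤ d lam`). -/
noncomputable def split (lam : Λ.Path) (m : Fin k → ℕ) : Λ.Path × Λ.Path :=
  if h : m ≤ Λ.d lam then
    (Λ.factor lam m (Λ.d lam - m) (by
      funext i
      exact (Nat.add_sub_cancel' (h i)).symm)).choose
  else (lam, lam)

/-- The segment `λ(m,n)` of the path `λ`: the unique path of degree `n - m` such that
`λ = λ(0,m) λ(m,n) λ(n, d λ)` (meaningful for `m ≤ n ≤ d λ`). -/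
noncomputable def seg (lam : Λ.Path) (m n : Fin k → ℕ) : Λ.Path :=
  (Λ.split (Λ.split lam n).1 m).2

/-- `MCE(μ,ν)`: minimal common extensions of `μ` and `ν`. -/
def MCE (mu nu : Λ.Path) : Set Λ.Path :=
  {lam | Λ.d lam = Λ.d mu ⊔ Λ.d nu ∧ Λ.seg lam 0 (Λ.d mu) = mu ∧ Λ.seg lam 0 (Λ.d nu) = nu}

/-- `Λ^min(μ,ν) = {(α,β) : μα = νβ ∈ MCE(μ,ν)}`. -/
def Lmin (mu nu : Λ.Path) : Set (Λ.Path × Λ.Path) :=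
  {p | Λ.s mu = Λ.r p.1 ∧ Λ.s nu = Λ.r p.2 ∧ Λ.comp mu p.1 = Λ.comp nu p.2 ∧
    Λ.comp mu p.1 ∈ Λ.MCE mu nu}

/-- `Ext(μ;E)`: extensions of `μ` with respect to `E`. -/
def Ext (mu : Λ.Path) (E : Set Λ.Path) : Set Λ.Path :=
  {a | Λ.r a = Λ.s mu ∧ ∃ nu ∈ E, ∃ b, (a, b) ∈ Λ.Lmin mu nu}

/-- `Λ` is finitely aligned if all the sets `MCE(μ,ν)` are finite. -/
def FinitelyAligned : Prop := ∀ mu nu, (Λ.MCE mu nu).Finite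

/-- `E ⊆ vΛ` is exhaustive if `Ext(λ;E) ≠ ∅` for all `λ ∈ vΛ`. -/
def Exhaustive (v : Λ.Path) (E : Set Λ.Path) : Prop :=
  ∀ lam, Λ.r lam = v → (Λ.Ext lam E).Nonempty

/-- `E ∈ vFE(Λ)`: `E ⊆ vΛ \ {v}` is finite and exhaustive (so `r(E) = v`). -/
def FEat (v : Λ.Path) (E : Set Λ.Path) : Prop :=
  Λ.IsVertex v ∧ (∀ lam ∈ E, Λ.r lam = v ∧ lam ≠ v) ∧ E.Finite ∧ Λ.Exhaustive v E

/-- `FE(Λ)`: the finite exhaustive sets. -/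
def FE : Set (Set Λ.Path) := {E | ∃ v, Λ.FEat v E}

/-- `λE = {λμ : μ ∈ E, r(μ) = s(λ)}`. -/
def lamSet (lam : Λ.Path) (E : Set Λ.Path) : Set Λ.Path :=
  {x | ∃ mu ∈ E, Λ.s lam = Λ.r mu ∧ Λ.comp lam mu = x}

/-- `EΛ = {λμ : λ ∈ E, r(μ) = s(λ)}`. -/
def setLam (E : Set Λ.Path) : Set Λ.Path :=
  {x | ∃ lam ∈ E, ∃ mu, Λ.s lam = Λ.r mu ∧ Λ.comp lam mu = x}

/-- `𝓔 ⊆ FE(Λ)` is satiated if it satisfies (S1)--(S4). -/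
def Satiated (𝓔 : Set (Set Λ.Path)) : Prop :=
  𝓔 ⊆ Λ.FE ∧
  (∀ G ∈ 𝓔, ∀ E ∈ Λ.FE, G ⊆ E → E ∈ 𝓔) ∧
  (∀ G ∈ 𝓔, ∀ v, Λ.FEat v G → ∀ mu, Λ.r mu = v → mu ∉ Λ.setLam G → Λ.Ext mu G ∈ 𝓔) ∧
  (∀ G ∈ 𝓔, ∀ n : Λ.Path → Fin k → ℕ, (∀ lam ∈ G, 0 < n lam ∧ n lam ≤ Λ.d lam) →
    ((fun lam => Λ.seg lam 0 (n lam)) '' G) ∈ 𝓔) ∧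
  (∀ G ∈ 𝓔, ∀ G' ⊆ G, ∀ Gl : Λ.Path → Set Λ.Path,
    (∀ lam ∈ G', Gl lam ∈ 𝓔 ∧ Λ.FEat (Λ.s lam) (Gl lam)) →
    ((G \ G') ∪ ⋃ lam ∈ G', Λ.lamSet lam (Gl lam)) ∈ 𝓔)

/-- The satiation `𝓔̄` of `𝓔`: the smallest satiated subset of `FE(Λ)` containing `𝓔`. -/
def satiation (𝓔 : Set (Set Λ.Path)) : Set (Set Λ.Path) :=
  ⋂₀ {F | 𝓔 ⊆ F ∧ Λ.Satiated F}

/-- `ΠE`: the smallest subset of `Λ` containing `E` which is closed under the operation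
`(λ,μ,σ) ↦ λ Ext(μ;{σ})` for `λ,μ,σ ∈ ΠE` with `d(λ) = d(μ)`, `s(λ) = s(μ)`. -/
def PiSet (E : Set Λ.Path) : Set Λ.Path :=
  ⋂₀ {G | E ⊆ G ∧ ∀ lam mu sig, lam ∈ G → mu ∈ G → sig ∈ G →
    Λ.d lam = Λ.d mu → Λ.s lam = Λ.s mu → Λ.lamSet lam (Λ.Ext mu {sig}) ⊆ G}

/-- `Σ₁(𝓔)`: finite sets `F ⊆ r(E)Λ \ Λ⁰` containing some `E ∈ 𝓔`. -/
def Sig1 (𝓔 : Set (Set Λ.Path)) : Set (Set Λ.Path) :=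
  {F | ∃ E ∈ 𝓔, ∃ v, Λ.FEat v E ∧ E ⊆ F ∧ F.Finite ∧
    ∀ lam ∈ F, Λ.r lam = v ∧ ¬ Λ.IsVertex lam}

/-- `Σ₂(𝓔) = {Ext(μ;E) : E ∈ 𝓔, μ ∈ r(E)Λ \ EΛ}`. -/
def Sig2 (𝓔 : Set (Set Λ.Path)) : Set (Set Λ.Path) :=
  {F | ∃ E ∈ 𝓔, ∃ v, Λ.FEat v E ∧ ∃ mu, Λ.r mu = v ∧ mu ∉ Λ.setLam E ∧ F = Λ.Ext mu E}

/-- `Σ₃(𝓔) = {{λ(0,n_λ) : λ ∈ E} : E ∈ 𝓔, 0 < n_λ ≤ d(λ)}`. -/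
def Sig3 (𝓔 : Set (Set Λ.Path)) : Set (Set Λ.Path) :=
  {F | ∃ E ∈ 𝓔, ∃ n : Λ.Path → Fin k → ℕ, (∀ lam ∈ E, 0 < n lam ∧ n lam ≤ Λ.d lam) ∧
    F = (fun lam => Λ.seg lam 0 (n lam)) '' E}

/-- `Σ₄(𝓔) = {(E \ F) ∪ ⋃_{λ ∈ F} λ F_λ : E ∈ 𝓔, F ⊆ E, F_λ ∈ s(λ)𝓔}`. -/
def Sig4 (𝓔 : Set (Set Λ.Path)) : Set (Set Λ.Path) :=
  {G | ∃ E ∈ 𝓔, ∃ F ⊆ E, ∃ Fl : Λ.Path → Set Λ.Path,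
    (∀ lam ∈ F, Fl lam ∈ 𝓔 ∧ Λ.FEat (Λ.s lam) (Fl lam)) ∧
    G = (E \ F) ∪ ⋃ lam ∈ F, Λ.lamSet lam (Fl lam)}

/-- `Σ = Σ₄ ∘ Σ₃ ∘ Σ₂ ∘ Σ₁`. -/
def SigmaStep (𝓔 : Set (Set Λ.Path)) : Set (Set Λ.Path) :=
  Λ.Sig4 (Λ.Sig3 (Λ.Sig2 (Λ.Sig1 𝓔)))

/-- `Σ^∞(𝓔) = ⋃_{n ≥ 1} Σ^n(𝓔)`. -/
def SigmaInf (𝓔 : Set (Set Λ.Path)) : Set (Set Λ.Path) :=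
  ⋃ n : ℕ, (Λ.SigmaStep)^[n + 1] 𝓔

section StarAlgebra

variable {A : Type*} [Ring A] [StarRing A]

/-- The product `∏_{λ ∈ E} (t_v - t_λ t_λ*)` (the factors pairwise commute for any
family satisfying (TCK1)--(TCK3), so the implicit choice of ordering is immaterial). -/
noncomputable def gapProd (t : Λ.Path → A) (v : Λ.Path) (E : Set Λ.Path) : A :=
  listProd E fun lam => t v - t lam * star (t lam)

/-- Conditions (TCK1)--(TCK3) on a family `{t_λ}`. -/
def TCKFamily (t : Λ.Path → A) : Prop :=
  (∀ v, Λ.IsVertex v → star (t v) = t v ∧ t v * t v = t v) ∧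
  (∀ v w, Λ.IsVertex v → Λ.IsVertex w → v ≠ w → t v * t w = 0) ∧
  (∀ lam mu, Λ.s lam = Λ.r mu → t lam * t mu = t (Λ.comp lam mu)) ∧
  (∀ lam mu, star (t lam) * t mu = ∑ᶠ p ∈ Λ.Lmin lam mu, t p.1 * star (t p.2))

/-- A relative Cuntz-Krieger `(Λ;𝓔)`-family: (TCK1)--(TCK3) together with (CK). -/
def RCKFamily (𝓔 : Set (Set Λ.Path)) (t : Λ.Path → A) : Prop :=
  Λ.TCKFamily t ∧ ∀ E ∈ 𝓔, ∀ v, Λ.FEat v E → Λ.gapProd t v E = 0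

/-- `Θ(t)^{ΠE}_{λ,μ} = t_λ (∏_{λν ∈ ΠE, d(ν) > 0} (t_{s(λ)} - t_ν t_ν*)) t_μ*`. -/
noncomputable def Theta (t : Λ.Path → A) (E : Set Λ.Path) (lam mu : Λ.Path) : A :=
  t lam *
    listProd {nu | Λ.s lam = Λ.r nu ∧ ¬ Λ.IsVertex nu ∧ Λ.comp lam nu ∈ Λ.PiSet E}
      (fun nu => t (Λ.s lam) - t nu * star (t nu)) *
    star (t mu)

end StarAlgebra

end KGraph

/-- A graph morphism `x : Ω_{k,m} → Λ`, encoded by its length `m = d(x) ∈ (ℕ∪{∞})^k`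
and its values `x(p,q)` on the morphisms `(p,q)` of `Ω_{k,m}` (with the junk value
`x(0,0)` outside the meaningful domain, so graph morphisms are extensional). -/
structure GMor {k : ℕ} (Λ : KGraph k) where
  len : Fin k → ℕ∞
  seg : (Fin k → ℕ) → (Fin k → ℕ) → Λ.Path
  d_seg : ∀ p q, p ≤ q → (∀ i, (q i : ℕ∞) ≤ len i) → Λ.d (seg p q) = q - p
  r_seg : ∀ p q, p ≤ q → (∀ i, (q i : ℕ∞) ≤ len i) → Λ.r (seg p q) = seg p p
  s_seg : ∀ p q, p ≤ q → (∀ i, (q i : ℕ∞) ≤ len i) → Λ.s (seg p q) = seg q q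
  comp_seg : ∀ p q u, p ≤ q → q ≤ u → (∀ i, (u i : ℕ∞) ≤ len i) →
    Λ.comp (seg p q) (seg q u) = seg p u
  seg_junk : ∀ p q, ¬ (p ≤ q ∧ ∀ i, (q i : ℕ∞) ≤ len i) → seg p q = seg 0 0

namespace GMor

variable {k : ℕ} {Λ : KGraph k}

/-- The range `r(x) = x(0)` of a graph morphism. -/
def range (x : GMor Λ) : Λ.Path := x.seg 0 0

/-- `y = x|_n^{d(x)}`, the restriction of `x` (defined for `n ≤ d(x)`):
`d(y) = d(x) - n` and `y(p,q) = x(n+p, n+q)`. -/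
def IsRestriction (y x : GMor Λ) (n : Fin k → ℕ) : Prop :=
  (∀ i, y.len i = x.len i - (n i : ℕ∞)) ∧
  ∀ p q, p ≤ q → (∀ i, (q i : ℕ∞) ≤ y.len i) → y.seg p q = x.seg (n + p) (n + q)

/-- `y = λx`, the extension of `x` by `λ ∈ Λ r(x)`: `d(y) = d(λ) + d(x)`,
`y(0, d(λ)) = λ` and `y(d(λ), d(λ)+n) = x(0,n)` for `n ≤ d(x)`. -/
def IsExtension (y : GMor Λ) (lam : Λ.Path) (x : GMor Λ) : Prop :=
  (∀ i, y.len i = (Λ.d lam i : ℕ∞) + x.len i) ∧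
  y.seg 0 (Λ.d lam) = lam ∧
  ∀ n : Fin k → ℕ, (∀ i, (n i : ℕ∞) ≤ x.len i) →
    y.seg (Λ.d lam) (Λ.d lam + n) = x.seg 0 n

/-- `x ∈ FΛ^∞`: `x` has an initial segment belonging to `F`. -/
def HasInit (x : GMor Λ) (F : Set Λ.Path) : Prop :=
  ∃ lam ∈ F, (∀ i, (Λ.d lam i : ℕ∞) ≤ x.len i) ∧ x.seg 0 (Λ.d lam) = lam

/-- `z` restricts to `x` on `Ω_{k, d(x)}`. -/
def Agrees (z x : GMor Λ) : Prop :=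
  ∀ p q, p ≤ q → (∀ i, (q i : ℕ∞) ≤ x.len i) → z.seg p q = x.seg p q

/-- `z ∈ MCE(x,y)` for graph morphisms `x, y`. -/
def IsMCE (z x y : GMor Λ) : Prop :=
  (∀ i, z.len i = max (x.len i) (y.len i)) ∧ z.Agrees x ∧ z.Agrees y

/-- `x` is aperiodic: for distinct `λ, μ ∈ Λ r(x)`, `MCE(λx, μx) = ∅`. -/
def Aperiodic (x : GMor Λ) : Prop :=
  ∀ lam mu : Λ.Path, lam ≠ mu → Λ.s lam = x.range → Λ.s mu = x.range →
    ∀ lx mx : GMor Λ, lx.IsExtension lam x → mx.IsExtension mu x →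
      ∀ z : GMor Λ, ¬ z.IsMCE lx mx

end GMor

namespace KGraph

variable {k : ℕ} (Λ : KGraph k)

/-- `x ∈ ∂(Λ;𝓔)`: an `𝓔`-compatible boundary path. -/
def IsBdry (𝓔 : Set (Set Λ.Path)) (x : GMor Λ) : Prop :=
  ∀ n : Fin k → ℕ, (∀ i, (n i : ℕ∞) ≤ x.len i) →
    ∀ E ∈ 𝓔, Λ.FEat (x.seg n n) E →
      ∃ lam ∈ E, (∀ i, ((n + Λ.d lam) i : ℕ∞) ≤ x.len i) ∧ x.seg n (n + Λ.d lam) = lam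

/-- Condition (C): aperiodic `𝓔`-compatible boundary paths out of every vertex, and
avoiding any given `F ∈ vFE(Λ) \ 𝓔`. -/
def CondC (𝓔 : Set (Set Λ.Path)) : Prop :=
  (∀ v, Λ.IsVertex v → ∃ x : GMor Λ, Λ.IsBdry 𝓔 x ∧ x.range = v ∧ x.Aperiodic) ∧
  (∀ v F, Λ.FEat v F → F ∉ 𝓔 →
    ∃ x : GMor Λ, Λ.IsBdry 𝓔 x ∧ x.range = v ∧ ¬ x.HasInit F ∧ x.Aperiodic)

end KGraph

namespace KGraph

variable {k : ℕ} (Λ : KGraph k)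

/-- `mid` is the segment of `lam` between positions `p` and `q`. -/
def IsSeg (lam : Λ.Path) (p q : Fin k → ℕ) (mid : Λ.Path) : Prop :=
  ∃ a c, Λ.s a = Λ.r mid ∧ Λ.s mid = Λ.r c ∧ Λ.d a = p ∧ p + Λ.d mid = q ∧
    Λ.comp (Λ.comp a mid) c = lam

variable {Λ}

lemma split_comp {a b : Λ.Path} (h : Λ.s a = Λ.r b) :
    Λ.split (Λ.comp a b) (Λ.d a) = (a, b) := by
  have hd := Λ.d_comp a b h
  have hle : Λ.d a ≤ Λ.d (Λ.comp a b) := by rw [hd]; exact le_self_add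
  have hex := Λ.factor (Λ.comp a b) (Λ.d a) (Λ.d (Λ.comp a b) - Λ.d a)
    (add_tsub_cancel_of_le hle).symm
  rw [split, dif_pos hle]
  exact hex.unique hex.choose_spec.1 ⟨h, rfl, by simp [hd], rfl⟩

lemma exists_factor {lam : Λ.Path} {m : Fin k → ℕ} (h : m ≤ Λ.d lam) :
    ∃ a b, Λ.s a = Λ.r b ∧ Λ.d a = m ∧ Λ.comp a b = lam := by
  obtain ⟨⟨a, b⟩, ⟨h₁, h₂, -, h₃⟩, -⟩ :=
    Λ.factor lam m (Λ.d lam - m) (add_tsub_cancel_of_le h).symm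
  exact ⟨a, b, h₁, h₂, h₃⟩

lemma IsSeg.seg_eq {lam mid : Λ.Path} {p q : Fin k → ℕ} (h : Λ.IsSeg lam p q mid) :
    Λ.seg lam p q = mid := by
  obtain ⟨a, c, h₁, h₂, rfl, rfl, rfl⟩ := h
  rw [seg, ← Λ.d_comp _ _ h₁, split_comp ((Λ.s_comp _ _ h₁).trans h₂), split_comp h₁]

lemma isSeg_seg {lam : Λ.Path} {p q : Fin k → ℕ} (hpq : p ≤ q) (hq : q ≤ Λ.d lam) :
    Λ.IsSeg lam p q (Λ.seg lam p q) := by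
  obtain ⟨e, c, he, rfl, rfl⟩ := exists_factor hq
  obtain ⟨a, b, hab, rfl, rfl⟩ := exists_factor hpq
  have h : Λ.IsSeg (Λ.comp (Λ.comp a b) c) (Λ.d a) (Λ.d (Λ.comp a b)) b :=
    ⟨a, c, hab, (Λ.s_comp _ _ hab).symm.trans he, rfl, (Λ.d_comp _ _ hab).symm, rfl⟩
  rwa [h.seg_eq]

lemma IsSeg.range {lam mid : Λ.Path} {p q : Fin k → ℕ} (h : Λ.IsSeg lam p q mid) :
    Λ.IsSeg lam p p (Λ.r mid) := by
  obtain ⟨a, c, h₁, h₂, rfl, rfl, rfl⟩ := h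
  refine ⟨a, Λ.comp mid c, by rw [h₁, Λ.r_r], by rw [Λ.s_r, Λ.r_comp _ _ h₂], rfl,
    by rw [Λ.d_r, add_zero], ?_⟩
  rw [← h₁, Λ.comp_source, Λ.comp_assoc _ _ _ h₁ h₂]

lemma IsSeg.source {lam mid : Λ.Path} {p q : Fin k → ℕ} (h : Λ.IsSeg lam p q mid) :
    Λ.IsSeg lam q q (Λ.s mid) := by
  obtain ⟨a, c, h₁, h₂, rfl, rfl, rfl⟩ := h
  refine ⟨Λ.comp a mid, c, by rw [Λ.s_comp _ _ h₁, Λ.r_s], by rw [Λ.s_s, h₂],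
    Λ.d_comp _ _ h₁, by rw [Λ.d_s, add_zero], ?_⟩
  rw [← Λ.s_comp _ _ h₁, Λ.comp_source]

lemma IsSeg.d_eq {lam mid : Λ.Path} {p q : Fin k → ℕ} (h : Λ.IsSeg lam p q mid) :
    Λ.d mid = q - p := by
  obtain ⟨a, c, h₁, h₂, rfl, rfl, rfl⟩ := h
  simp

lemma seg_comp_seg {lam : Λ.Path} {p q u : Fin k → ℕ} (hpq : p ≤ q) (hqu : q ≤ u)
    (hu : u ≤ Λ.d lam) : Λ.comp (Λ.seg lam p q) (Λ.seg lam q u) = Λ.seg lam p u := by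
  obtain ⟨e, z, he, rfl, rfl⟩ := exists_factor hu
  obtain ⟨f, c, hf, rfl, rfl⟩ := exists_factor hqu
  obtain ⟨a, b, hab, rfl, rfl⟩ := exists_factor hpq
  have hbc : Λ.s b = Λ.r c := (Λ.s_comp _ _ hab).symm.trans hf
  have hcz : Λ.s c = Λ.r z := (Λ.s_comp _ _ hf).symm.trans he
  have hbcz : Λ.s b = Λ.r (Λ.comp c z) := by rw [Λ.r_comp _ _ hcz, hbc]
  have habc : Λ.s a = Λ.r (Λ.comp b c) := by rw [Λ.r_comp _ _ hbc, hab]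
  rw [IsSeg.seg_eq (mid := b) ⟨a, Λ.comp c z, hab, hbcz, rfl, (Λ.d_comp _ _ hab).symm,
      (Λ.comp_assoc _ _ _ hf hcz).symm⟩,
    IsSeg.seg_eq (mid := c) ⟨Λ.comp a b, z, hf, hcz, rfl, (Λ.d_comp _ _ hf).symm, rfl⟩,
    IsSeg.seg_eq (mid := Λ.comp b c) ⟨a, z, habc, (Λ.s_comp _ _ hbc).trans hcz, rfl, ?_, ?_⟩]
  · rw [Λ.d_comp _ _ hf, Λ.d_comp _ _ hab, Λ.d_comp _ _ hbc, add_assoc]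
  · rw [Λ.comp_assoc _ _ _ hab hbc]

lemma IsSeg.comp_right {lam mid nu : Λ.Path} {p q : Fin k → ℕ} (h : Λ.IsSeg lam p q mid)
    (hnu : Λ.s lam = Λ.r nu) : Λ.IsSeg (Λ.comp lam nu) p q mid := by
  obtain ⟨a, c, h₁, h₂, h₃, h₄, rfl⟩ := h
  have h₅ : Λ.s (Λ.comp a mid) = Λ.r c := (Λ.s_comp _ _ h₁).trans h₂
  have h₆ : Λ.s c = Λ.r nu := (Λ.s_comp _ _ h₅).symm.trans hnu
  exact ⟨a, Λ.comp c nu, h₁, by rw [Λ.r_comp _ _ h₆, h₂], h₃, h₄,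
    (Λ.comp_assoc _ _ _ h₅ h₆).symm⟩

variable (Λ) in
/-- The set `vΛ` of paths with range `v`. -/
structure PathsFrom (v : Λ.Path) where
  path : Λ.Path
  r_path : Λ.r path = v

/-- Paths are ordered by extension. -/
instance (v : Λ.Path) : Preorder (Λ.PathsFrom v) where
  le lam mu := ∃ nu, Λ.s lam.1 = Λ.r nu ∧ Λ.comp lam.1 nu = mu.1
  le_refl lam := ⟨Λ.s lam.1, (Λ.r_s _).symm, Λ.comp_source _⟩
  le_trans := by
    rintro lam mu tau ⟨a, ha, ha'⟩ ⟨b, hb, hb'⟩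
    rw [← ha', Λ.s_comp _ _ ha] at hb
    refine ⟨Λ.comp a b, by rw [Λ.r_comp _ _ hb, ha], ?_⟩
    rw [← Λ.comp_assoc _ _ _ ha hb, ha', hb']

namespace PathsFrom

variable {v : Λ.Path}

lemma d_mono {lam mu : Λ.PathsFrom v} (h : lam ≤ mu) : Λ.d lam.1 ≤ Λ.d mu.1 := by
  obtain ⟨nu, h₁, h₂⟩ := h
  rw [← h₂, Λ.d_comp _ _ h₁]
  exact le_self_add

lemma seg_eq_of_le {lam mu : Λ.PathsFrom v} (h : lam ≤ mu) {p q : Fin k → ℕ}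
    (hpq : p ≤ q) (hq : q ≤ Λ.d lam.1) : Λ.seg mu.1 p q = Λ.seg lam.1 p q := by
  obtain ⟨nu, h₁, h₂⟩ := h
  rw [← h₂]
  exact ((isSeg_seg hpq hq).comp_right h₁).seg_eq

lemma seg_zero (lam : Λ.PathsFrom v) : Λ.seg lam.1 0 0 = v := by
  apply IsSeg.seg_eq
  have hv : Λ.r v = v := by rw [← lam.2, Λ.r_r]
  have hs : Λ.s v = v := by rw [← lam.2, Λ.s_r]
  have hd : Λ.d v = 0 := by rw [← lam.2, Λ.d_r]
  have hc : Λ.comp v v = v := by simpa [hv] using Λ.range_comp v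
  refine ⟨v, lam.1, by rw [hs, hv], by rw [hs, lam.2], hd, by rw [hd, add_zero], ?_⟩
  rw [hc]
  simpa [lam.2] using Λ.range_comp lam.1

/-- `lam` passes through an element of `E` at position `n`. -/
def Meets (lam : Λ.PathsFrom v) (n : Fin k → ℕ) (E : Set Λ.Path) : Prop :=
  ∃ nu ∈ E, n + Λ.d nu ≤ Λ.d lam.1 ∧ Λ.seg lam.1 n (n + Λ.d nu) = nu

/-- A path through a vertex at which `E` is exhaustive extends to one that meets `E` there. -/
lemma exists_le_meets (lam : Λ.PathsFrom v) {n : Fin k → ℕ} {E : Set Λ.Path}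
    (hn : n ≤ Λ.d lam.1) (hE : Λ.Exhaustive (Λ.seg lam.1 n n) E) :
    ∃ mu, lam ≤ mu ∧ mu.Meets n E := by
  obtain ⟨lam, hlam⟩ := lam
  obtain ⟨a, e, hae, rfl, rfl⟩ := exists_factor hn
  have hseg : Λ.seg (Λ.comp a e) (Λ.d a) (Λ.d a) = Λ.r e := by
    apply IsSeg.seg_eq
    refine ⟨a, e, by rw [hae, Λ.r_r], by rw [Λ.s_r], rfl, by rw [Λ.d_r, add_zero], ?_⟩
    rw [← hae, Λ.comp_source]
  obtain ⟨α, hα, nu, hnu, β, h₁, h₂, h₃, -⟩ := hE e hseg.symm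
  have hs : Λ.s (Λ.comp a e) = Λ.r α := (Λ.s_comp _ _ hae).trans h₁
  have hanu : Λ.s a = Λ.r nu := by
    rw [hae, ← Λ.r_comp _ _ h₁, h₃, Λ.r_comp _ _ h₂]
  have heq : Λ.comp (Λ.comp a e) α = Λ.comp (Λ.comp a nu) β := by
    rw [Λ.comp_assoc _ _ _ hae h₁, h₃, Λ.comp_assoc _ _ _ hanu h₂]
  refine ⟨⟨Λ.comp (Λ.comp a e) α, (Λ.r_comp _ _ hs).trans hlam⟩, ⟨α, hs, rfl⟩,
    nu, hnu, ?_, IsSeg.seg_eq ⟨a, β, hanu, h₂, rfl, rfl, heq.symm⟩⟩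
  change Λ.d a + Λ.d nu ≤ Λ.d (Λ.comp (Λ.comp a e) α)
  rw [heq, Λ.d_comp _ _ ((Λ.s_comp _ _ hanu).trans h₂), Λ.d_comp _ _ hanu]
  exact le_self_add

variable (v) in
/-- The paths that either meet `E` at position `n`, or have no extension whose vertex at
position `n` sees `E` as a finite exhaustive set. -/
def deciding (n : Fin k → ℕ) (E : Set Λ.Path) : Order.Cofinal (Λ.PathsFrom v) where
  carrier := {lam | lam.Meets n E ∨
    ∀ mu, lam ≤ mu → n ≤ Λ.d mu.1 → ¬ Λ.FEat (Λ.seg mu.1 n n) E}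
  isCofinal lam := by
    by_cases h : ∀ mu, lam ≤ mu → n ≤ Λ.d mu.1 → ¬ Λ.FEat (Λ.seg mu.1 n n) E
    · exact ⟨lam, Or.inr h, le_rfl⟩
    · push Not at h
      obtain ⟨mu, hle, hn, hE⟩ := h
      obtain ⟨tau, hτ, hm⟩ := mu.exists_le_meets hn hE.2.2.2
      exact ⟨tau, Or.inl hm, hle.trans hτ⟩

end PathsFrom

section Limit

variable {v : Λ.Path} (I : Order.Ideal (Λ.PathsFrom v))

/-- The pointwise supremum of the degrees of the members of `I`. -/
noncomputable def limitLen (i : Fin k) : ℕ∞ := ⨆ lam : I, (Λ.d lam.1.1 i : ℕ∞)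

/-- The common value of the segments from `p` to `q` of the members of `I`. -/
noncomputable def limitSeg (p q : Fin k → ℕ) : Λ.Path :=
  if h : p ≤ q ∧ ∃ lam ∈ I, q ≤ Λ.d lam.1 then Λ.seg h.2.choose.1 p q else v

variable {I}

lemma le_limitLen {lam : Λ.PathsFrom v} (hlam : lam ∈ I) {q : Fin k → ℕ}
    (hq : q ≤ Λ.d lam.1) (i : Fin k) : (q i : ℕ∞) ≤ limitLen I i :=
  (Nat.cast_le.mpr (hq i)).trans
    (le_iSup (fun lam : I => (Λ.d lam.1.1 i : ℕ∞)) ⟨lam, hlam⟩)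

lemma exists_mem_le_d {q : Fin k → ℕ} (hq : ∀ i, (q i : ℕ∞) ≤ limitLen I i) :
    ∃ lam ∈ I, q ≤ Λ.d lam.1 := by
  have hi : ∀ i, ∃ lam : I, q i ≤ Λ.d lam.1.1 i := by
    intro i
    obtain ⟨lam, hlam⟩ := I.nonempty
    rcases hn : q i with _ | n
    · exact ⟨⟨lam, hlam⟩, Nat.zero_le _⟩
    · have hlt : (n : ℕ∞) < limitLen I i :=
        lt_of_lt_of_le (Nat.cast_lt.mpr (by omega)) (hq i)
      obtain ⟨mu, hmu⟩ := lt_iSup_iff.mp hlt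
      exact ⟨mu, Nat.cast_lt.mp hmu⟩
  choose f hf using hi
  have : Nonempty I := I.nonempty.to_subtype
  obtain ⟨mu, hmu⟩ := (directedOn_iff_directed.mp I.directed).finite_le f
  exact ⟨mu.1, mu.2, fun i => (hf i).trans (PathsFrom.d_mono (hmu i) i)⟩

lemma limitSeg_eq {lam : Λ.PathsFrom v} (hlam : lam ∈ I) {p q : Fin k → ℕ}
    (hpq : p ≤ q) (hq : q ≤ Λ.d lam.1) : limitSeg I p q = Λ.seg lam.1 p q := by
  have h : p ≤ q ∧ ∃ lam ∈ I, q ≤ Λ.d lam.1 := ⟨hpq, lam, hlam, hq⟩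
  rw [limitSeg, dif_pos h]
  obtain ⟨hmem, hle⟩ := h.2.choose_spec
  obtain ⟨mu, -, h₁, h₂⟩ := I.directed _ hmem _ hlam
  rw [← PathsFrom.seg_eq_of_le h₁ hpq hle, ← PathsFrom.seg_eq_of_le h₂ hpq hq]

lemma limitSeg_zero : limitSeg I 0 0 = v := by
  obtain ⟨lam, hlam⟩ := I.nonempty
  exact (limitSeg_eq hlam le_rfl fun _ => Nat.zero_le _).trans lam.seg_zero

variable (I) in
/-- The graph morphism determined by a directed family of paths. -/
noncomputable def limit : GMor Λ where
  len := limitLen I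
  seg := limitSeg I
  d_seg p q hpq hq := by
    obtain ⟨lam, hlam, hle⟩ := exists_mem_le_d hq
    rw [limitSeg_eq hlam hpq hle, (isSeg_seg hpq hle).d_eq]
  r_seg p q hpq hq := by
    obtain ⟨lam, hlam, hle⟩ := exists_mem_le_d hq
    rw [limitSeg_eq hlam hpq hle, limitSeg_eq hlam le_rfl (hpq.trans hle),
      (isSeg_seg hpq hle).range.seg_eq]
  s_seg p q hpq hq := by
    obtain ⟨lam, hlam, hle⟩ := exists_mem_le_d hq
    rw [limitSeg_eq hlam hpq hle, limitSeg_eq hlam le_rfl hle,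
      (isSeg_seg hpq hle).source.seg_eq]
  comp_seg p q u hpq hqu hu := by
    obtain ⟨lam, hlam, hle⟩ := exists_mem_le_d hu
    rw [limitSeg_eq hlam hpq (hqu.trans hle), limitSeg_eq hlam hqu hle,
      limitSeg_eq hlam (hpq.trans hqu) hle, seg_comp_seg hpq hqu hle]
  seg_junk p q h := by
    rw [limitSeg_zero, limitSeg, dif_neg]
    rintro ⟨hpq, lam, hlam, hle⟩
    exact h ⟨hpq, le_limitLen hlam hle⟩

/-- An ideal meeting every set `PathsFrom.deciding v n E` determines a boundary path. -/
lemma isBdry_limit (𝓔 : Set (Set Λ.Path))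
    (hI : ∀ n (E : Finset Λ.Path), ∃ lam ∈ PathsFrom.deciding v n (E : Set Λ.Path), lam ∈ I) :
    Λ.IsBdry 𝓔 (limit I) := by
  intro n hn E _ hE
  obtain ⟨lam, hlam, hle⟩ := exists_mem_le_d hn
  obtain ⟨mu, hdec, hmu⟩ := hI n hE.2.2.1.toFinset
  rw [Set.Finite.coe_toFinset] at hdec
  rcases hdec with ⟨nu, hnu, hd, hseg⟩ | hno
  · refine ⟨nu, hnu, le_limitLen hmu hd, ?_⟩
    exact (limitSeg_eq hmu le_self_add hd).trans hseg
  · obtain ⟨tau, hτ, h₁, h₂⟩ := I.directed _ hmu _ hlam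
    have hn' : n ≤ Λ.d tau.1 := hle.trans (PathsFrom.d_mono h₂)
    refine absurd ?_ (hno tau h₁ hn')
    rw [← limitSeg_eq hτ le_rfl hn']
    exact hE

end Limit

end KGraph

/-- Lemma 4.8(1): `v ∂(Λ;𝓔)` is nonempty for every vertex `v`. -/
theorem statement4 {k : ℕ} (Λ : KGraph k) (hΛ : Λ.FinitelyAligned)
    (𝓔 : Set (Set Λ.Path)) (h𝓔 : Λ.Satiated 𝓔)
    (v : Λ.Path) (hv : Λ.IsVertex v) :
    ∃ x : GMor Λ, Λ.IsBdry 𝓔 x ∧ x.range = v := by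
  have := Λ.countable
  let : Encodable ((Fin k → ℕ) × Finset Λ.Path) := Encodable.ofCountable _
  have hr : Λ.r v = v := by
    obtain ⟨_, -, huniq⟩ := Λ.factor v 0 0 (by rw [add_zero]; exact hv)
    have h₁ := huniq (Λ.r v, v) ⟨Λ.s_r v, Λ.d_r v, hv, Λ.range_comp v⟩
    have h₂ := huniq (v, Λ.s v) ⟨(Λ.r_s v).symm, hv, Λ.d_s v, Λ.comp_source v⟩
    exact congrArg Prod.fst (h₁.trans h₂.symm)
  let D : (Fin k → ℕ) × Finset Λ.Path → Order.Cofinal (Λ.PathsFrom v) :=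
    fun nE => KGraph.PathsFrom.deciding v nE.1 (nE.2 : Set Λ.Path)
  refine ⟨KGraph.limit (Order.idealOfCofinals (⟨v, hr⟩ : Λ.PathsFrom v) D),
    KGraph.isBdry_limit 𝓔 fun n E => ?_, KGraph.limitSeg_zero⟩
  exact Order.cofinal_meets_idealOfCofinals _ D (n, E)
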